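/- Let X be a spectral forest. Then X is an Esakia space if and only if for every C ∈ qccl(X) the set C^min of minimal points of C is compact. -/

import Mathlib

open Set Topology

namespace PCF

variable {X : Type*}

/-- The compact open subsets of a topological space. -/
def qcop (t : TopologicalSpace X) : Set (Set X) :=
  {U | @IsOpen X t U ∧ @IsCompact X t U}

/-- The complements of the compact open subsets. -/
def qccl (t : TopologicalSpace X) : Set (Set X) :=
  {C | ∃ U ∈ qcop t, C = Uᶜ}

/-- The Boolean algebra of subsets generated by the compact open sets:
the constructible sets. -/
def Constructible (t : TopologicalSpace X) : Set (Set X) :=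
  ⋂₀ {B : Set (Set X) | qcop t ⊆ B ∧ (∀ s ∈ B, sᶜ ∈ B) ∧
        (∀ s ∈ B, ∀ u ∈ B, s ∪ u ∈ B) ∧ (∅ : Set X) ∈ B}

/-- The patch topology: generated by the compact open sets together with their
complements (equivalently, by the constructible sets). -/
def patchTop (t : TopologicalSpace X) : TopologicalSpace X :=
  TopologicalSpace.generateFrom (qcop t ∪ qccl t)

/-- The inverse topology, with the complements of compact opens as a basis of opens. -/
def invTop (t : TopologicalSpace X) : TopologicalSpace X :=
  TopologicalSpace.generateFrom (qccl t)

/-- The specialization order: `x ≤ y` iff `y` is in the closure of `{x}`. -/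
def specLE (t : TopologicalSpace X) (x y : X) : Prop := y ∈ @closure X t {x}

/-- Minimal points for the specialization order. -/
def minPts (t : TopologicalSpace X) : Set X := {x | ∀ y, specLE t y x → y = x}

/-- Maximal points for the specialization order. -/
def maxPts (t : TopologicalSpace X) : Set X := {x | ∀ y, specLE t x y → y = x}

/-- Minimal points of a subset `S`, for the induced specialization order. -/
def minPtsIn (t : TopologicalSpace X) (S : Set X) : Set X :=
  {x | x ∈ S ∧ ∀ y ∈ S, specLE t y x → y = x}

/-- Maximal points of a subset `S`, for the induced specialization order. -/
def maxPtsIn (t : TopologicalSpace X) (S : Set X) : Set X :=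
  {x | x ∈ S ∧ ∀ y ∈ S, specLE t x y → y = x}

/-- The down-set (set of generalizations) generated by `S`. -/
def downset (t : TopologicalSpace X) (S : Set X) : Set X :=
  {x | ∃ s ∈ S, specLE t x s}

/-- The up-set (set of specializations) generated by `S`. -/
def upset (t : TopologicalSpace X) (S : Set X) : Set X :=
  {x | ∃ s ∈ S, specLE t s x}

/-- A topology is spectral if the space is compact, sober (quasi-sober and T0),
the compact opens form a basis, and the compact opens are closed under
finite intersections. -/
def IsSpectral (t : TopologicalSpace X) : Prop :=
  @CompactSpace X t ∧ @QuasiSober X t ∧ @T0Space X t ∧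
  @TopologicalSpace.IsTopologicalBasis X t (qcop t) ∧
  ∀ U ∈ qcop t, ∀ V ∈ qcop t, U ∩ V ∈ qcop t

/-- A Boolean space: compact, Hausdorff and zero-dimensional. -/
def IsBooleanSpace (t : TopologicalSpace X) : Prop :=
  @CompactSpace X t ∧ @T2Space X t ∧
  @TopologicalSpace.IsTopologicalBasis X t {U | @IsClopen X t U}

/-- `V` is the pseudocomplement of `U` in the lattice of sets `L` (ordered by
inclusion, with meet given by intersection and bottom element `∅`): `V` is the
largest element of `L` disjoint from `U`. -/
def IsPseudoCompl (L : Set (Set X)) (U V : Set X) : Prop :=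
  V ∈ L ∧ U ∩ V = ∅ ∧ ∀ W ∈ L, U ∩ W = ∅ → W ⊆ V

/-- The lattice of sets `L` is pseudocomplemented: every element has a
pseudocomplement. -/
def Pseudocomplemented (L : Set (Set X)) : Prop :=
  ∀ U ∈ L, ∃ V, IsPseudoCompl L U V

/-- The lattice of sets `L` is a Stone algebra: it is pseudocomplemented and
`U* ∪ U** = ⊤` for every `U`. -/
def StoneAlgebra (L : Set (Set X)) : Prop :=
  Pseudocomplemented L ∧
  ∀ U ∈ L, ∀ V W : Set X, IsPseudoCompl L U V → IsPseudoCompl L V W → V ∪ W = univ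

/-- The lattice of sets `L` is a Heyting algebra: for all `U, V ∈ L` there is a
largest `W ∈ L` with `U ∩ W ⊆ V`. -/
def HeytingAlg (L : Set (Set X)) : Prop :=
  ∀ U ∈ L, ∀ V ∈ L, ∃ W ∈ L, U ∩ W ⊆ V ∧ ∀ W' ∈ L, U ∩ W' ⊆ V → W' ⊆ W

/-- A PC-space: the lattice of compact open sets is pseudocomplemented. -/
def IsPCSpace (t : TopologicalSpace X) : Prop := Pseudocomplemented (qcop t)

/-- An Esakia space: the closure of every constructible set is constructible. -/
def IsEsakia (t : TopologicalSpace X) : Prop :=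
  ∀ S ∈ Constructible t, @closure X t S ∈ Constructible t

/-- A spectral root system: the closure of every point is a specialization chain. -/
def IsRootSystem (t : TopologicalSpace X) : Prop :=
  ∀ x : X, IsChain (specLE t) (@closure X t {x})

/-- A spectral forest: the inverse space is a spectral root system. -/
def IsForest (t : TopologicalSpace X) : Prop := IsRootSystem (invTop t)

/-- A stranded space: the specialization poset is a disjoint union of chains, i.e.
the set of points comparable with any fixed point is a chain. -/
def Stranded (t : TopologicalSpace X) : Prop :=
  ∀ x : X, IsChain (specLE t) {y | specLE t x y ∨ specLE t y x}

end PCF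

open PCF

section Rings

variable (T : Type*) [TopologicalSpace T]

/-- The zero set of a continuous real-valued function. -/
def zeroSet (f : ContinuousMap T ℝ) : Set T := {t | f t = 0}

/-- The lattice of cozero sets of a topological space. -/
def Coz : Set (Set T) := {U | ∃ f : ContinuousMap T ℝ, U = {t | f t ≠ 0}}

/-- A z-ideal of the ring `C(T)` of continuous real-valued functions. -/
def IsZIdeal (I : Ideal (ContinuousMap T ℝ)) : Prop :=
  ∀ f ∈ I, ∀ g : ContinuousMap T ℝ, zeroSet T f ⊆ zeroSet T g → g ∈ I

/-- The prime z-ideals, as a subset of the prime spectrum of `C(T)`. -/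
def zSpec : Set (PrimeSpectrum (ContinuousMap T ℝ)) :=
  {p | IsZIdeal T p.asIdeal}

/-- A space is basically disconnected if the closure of every cozero set is open. -/
def BasicallyDisconnected : Prop :=
  ∀ f : ContinuousMap T ℝ, IsOpen (closure {t | f t ≠ 0})

/-- The Zariski topology on the prime spectrum of `C(T)`. -/
def specTop : TopologicalSpace (PrimeSpectrum (ContinuousMap T ℝ)) := inferInstance

/-- The subspace topology on the set of prime z-ideals. -/
def zTop : TopologicalSpace ↥(zSpec T) := inferInstance

end Rings

/-- The subspace topology on a subset. -/
def subTop {Y : Type*} [TopologicalSpace Y] (X : Set Y) : TopologicalSpace ↥X :=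
  inferInstance

section Spectral

variable {X : Type*} [t : TopologicalSpace X]

theorem PCF.IsSpectral.spectralSpace (hX : IsSpectral t) : SpectralSpace X where
  toT0Space := hX.2.2.1
  toCompactSpace := hX.1
  toQuasiSober := hX.2.1
  inter_isCompact U V hU hU' hV hV' := (hX.2.2.2.2 U ⟨hU, hU'⟩ V ⟨hV, hV'⟩).2
  isTopologicalBasis := hX.2.2.2.1

theorem specLE_iff_specializes {x y : X} : specLE t x y ↔ x ⤳ y :=
  specializes_iff_mem_closure.symm

theorem compactSpace_constructibleTopology [SpectralSpace X] :
    @CompactSpace X (constructibleTopology X) :=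
  @Function.Surjective.compactSpace (WithConstructibleTopology X) X inferInstance
    (constructibleTopology X) _ (WithTopology.continuous_ofTopology _) inferInstance
    (WithTopology.ofTopology_surjective _)

theorem isClopen_constructibleTopology_of_mem {S : Set X} (hS : S ∈ Constructible t) :
    @IsClopen X (constructibleTopology X) S := by
  refine mem_sInter.1 hS {S | @IsClopen X (constructibleTopology X) S} ⟨?_, ?_, ?_, ?_⟩
  · rintro U ⟨hU, hU'⟩
    refine ⟨@IsClosed.mk X (constructibleTopology X) _ ?_,
      hU'.isOpen_constructibleTopology_of_isOpen hU⟩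
    exact IsCompact.isOpen_constructibleTopology_of_isClosed (by rwa [compl_compl])
      hU.isClosed_compl
  · exact fun s hs => @IsClopen.compl X (constructibleTopology X) s hs
  · exact fun s hs u hu => @IsClopen.union X (constructibleTopology X) s u hs hu
  · exact @isClopen_empty X (constructibleTopology X)

theorem constructibleTopology_le [SpectralSpace X] : constructibleTopology X ≤ t := by
  intro U hU
  obtain ⟨S, hS, rfl⟩ := PrespectralSpace.isTopologicalBasis.open_eq_sUnion hU
  exact @isOpen_sUnion _ (constructibleTopology X) _ fun V hV =>
    (hS hV).2.isOpen_constructibleTopology_of_isOpen (hS hV).1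

theorem isCompact_of_isClosed_constructibleTopology [SpectralSpace X] {S : Set X}
    (hS : IsClosed[constructibleTopology X] S) : IsCompact S := by
  have := @IsClosed.isCompact X (constructibleTopology X) _ compactSpace_constructibleTopology hS
  have h := @IsCompact.image X X (constructibleTopology X) t _ id this
    (continuous_id_iff_le.2 constructibleTopology_le)
  rwa [image_id] at h

theorem exists_specializes_of_mem_closure [SpectralSpace X] {S : Set X} {x : X}
    (hS : IsClosed[constructibleTopology X] S) (hx : x ∈ closure S) : ∃ s ∈ S, s ⤳ x := by
  by_contra! h
  have hc := @IsClosed.isCompact X (constructibleTopology X) _ compactSpace_constructibleTopology hS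
  refine @IsCompact.induction_on X (constructibleTopology X) _ hc (fun S => x ∉ closure S)
    (by simp) (fun s u hsu hu hs => hu (closure_mono hsu hs))
    (fun s u hs hu => by simp [closure_union, hs, hu]) (fun s hs => ?_) hx
  obtain ⟨U, hU, hxU, hsU⟩ := not_specializes_iff_exists_open.1 (h s hs)
  obtain ⟨V, ⟨hV, hV'⟩, hxV, hVU⟩ :=
    PrespectralSpace.isTopologicalBasis.exists_subset_of_mem_open hxU hU
  refine ⟨Vᶜ, ?_, ?_⟩
  · refine @mem_nhdsWithin_of_mem_nhds X (constructibleTopology X) _ _ _ ?_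
    exact @IsOpen.mem_nhds X (constructibleTopology X) _ _
      (IsCompact.isOpen_constructibleTopology_of_isClosed (by rwa [compl_compl])
        hV.isClosed_compl) fun hs => hsU (hVU hs)
  · rw [hV.isClosed_compl.closure_eq]
    exact fun hx => hx hxV

theorem exists_mem_minPtsIn_specializes [SpectralSpace X] {C : Set X} (hC : IsClosed C)
    {x : X} (hx : x ∈ C) : ∃ c ∈ minPtsIn t C, c ⤳ x := by
  have : QuasiSober C := hC.isClosedEmbedding_subtypeVal.quasiSober
  have hI := isIrreducible_irreducibleComponent (x := (⟨x, hx⟩ : C))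
  have hg := hI.isGenericPoint_genericPoint isClosed_irreducibleComponent
  refine ⟨hI.genericPoint, ⟨hI.genericPoint.2, fun y hy hyg => ?_⟩, ?_⟩
  · have hyg' : (⟨y, hy⟩ : C) ⤳ hI.genericPoint := by
      rw [← Topology.IsInducing.subtypeVal.specializes_iff]
      exact specLE_iff_specializes.1 hyg
    have h := eq_irreducibleComponent (x := (⟨x, hx⟩ : C)) (s := closure {(⟨y, hy⟩ : C)})
      isIrreducible_singleton.closure.2
      (by rw [← hg.def]; exact hyg'.closure_subset)
    have hy' : IsGenericPoint (⟨y, hy⟩ : C) (irreducibleComponent ⟨x, hx⟩) := h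
    exact congrArg Subtype.val (hy'.eq hg)
  · exact Topology.IsInducing.subtypeVal.specializes_iff.2
      (hg.specializes mem_irreducibleComponent)

theorem specLE_invTop_iff [SpectralSpace X] {x y : X} : specLE (invTop t) x y ↔ y ⤳ x := by
  rw [specLE, @mem_closure_iff X (invTop t)]
  constructor
  · intro h
    by_contra hyx
    obtain ⟨O, hO, hxO, hyO⟩ := not_specializes_iff_exists_open.1 hyx
    obtain ⟨U, hU, hxU, hUO⟩ :=
      PrespectralSpace.isTopologicalBasis.exists_subset_of_mem_open hxO hO
    have hyU := fun hyU => hyO (hUO hyU)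
    obtain ⟨z, hz, rfl⟩ := h Uᶜ (.basic _ ⟨U, hU, rfl⟩) hyU
    exact hz hxU
  · refine fun h o ho hyo => ⟨x, ?_, rfl⟩
    induction ho with
    | basic _ hs =>
      obtain ⟨U, hU, rfl⟩ := hs
      exact h.mem_closed hU.1.isClosed_compl hyo
    | univ => trivial
    | inter _ _ _ _ ihs ihu => exact ⟨ihs hyo.1, ihu hyo.2⟩
    | sUnion _ _ ih =>
      obtain ⟨s, hs, hys⟩ := hyo
      exact ⟨s, hs, ih s hs hys⟩

theorem PCF.IsForest.specializes_total [SpectralSpace X] (h : IsForest t) {x y z : X}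
    (hx : x ⤳ z) (hy : y ⤳ z) : x ⤳ y ∨ y ⤳ x := by
  by_cases hxy : x = y
  · exact .inl (hxy ▸ specializes_rfl)
  · have : specLE (invTop t) x y ∨ specLE (invTop t) y x := h z (specLE_invTop_iff.2 hx)
      (specLE_invTop_iff.2 hy) hxy
    rwa [specLE_invTop_iff, specLE_invTop_iff, or_comm] at this

theorem mem_constructible_of_mem_qcop {U : Set X} (hU : U ∈ qcop t) : U ∈ Constructible t :=
  fun _ hB => hB.1 hU

theorem compl_mem_constructible {S : Set X} (hS : S ∈ Constructible t) :
    Sᶜ ∈ Constructible t :=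
  fun B hB => hB.2.1 _ (hS B hB)

theorem union_mem_constructible {S S' : Set X} (hS : S ∈ Constructible t)
    (hS' : S' ∈ Constructible t) : S ∪ S' ∈ Constructible t :=
  fun B hB => hB.2.2.1 _ (hS B hB) _ (hS' B hB)

theorem empty_mem_constructible : ∅ ∈ Constructible t :=
  fun _ hB => hB.2.2.2

theorem sdiff_mem_constructible {S S' : Set X} (hS : S ∈ Constructible t)
    (hS' : S' ∈ Constructible t) : S \ S' ∈ Constructible t := by
  rw [← compl_compl (S \ S'), sdiff_eq, compl_inter, compl_compl]
  exact compl_mem_constructible (union_mem_constructible (compl_mem_constructible hS) hS')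

theorem exists_finset_eq_sup_sdiff [SpectralSpace X] {S : Set X} (hS : S ∈ Constructible t) :
    ∃ F : Finset (qcop t × qcop t), S = F.sup fun p => p.1.1 \ p.2.1 := by
  refine (BooleanSubalgebra.mem_closure_iff_sup_sdiff ⟨?_, ?_⟩ ?_ ?_).1
    (hS (BooleanSubalgebra.closure (qcop t)) ⟨BooleanSubalgebra.subset_closure, ?_, ?_, ?_⟩)
  · exact fun U hU V hV => ⟨hU.1.union hV.1, hU.2.union hV.2⟩
  · exact fun U hU V hV =>
      ⟨hU.1.inter hV.1, QuasiSeparatedSpace.inter_isCompact U V hU.1 hU.2 hV.1 hV.2⟩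
  · exact ⟨isOpen_empty, isCompact_empty⟩
  · exact ⟨isOpen_univ, isCompact_univ⟩
  · exact fun s hs => BooleanSubalgebra.compl_mem hs
  · exact fun s hs u hu => BooleanSubalgebra.sup_mem hs hu
  · exact BooleanSubalgebra.bot_mem

/-- If the closures of all basic constructible sets are constructible, so is the closure of
every constructible set. -/
theorem isEsakia_of_closure_sdiff [SpectralSpace X]
    (h : ∀ U ∈ qcop t, ∀ V ∈ qcop t, closure (U \ V) ∈ Constructible t) : IsEsakia t := by
  classical
  intro S hS
  obtain ⟨F, rfl⟩ := exists_finset_eq_sup_sdiff hS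
  clear hS
  induction F using Finset.induction_on with
  | empty => simpa using empty_mem_constructible
  | insert p F _ ih =>
    rw [Finset.sup_insert]
    change closure (_ ∪ _) ∈ _
    rw [closure_union]
    exact union_mem_constructible (h _ p.1.2 _ p.2.2) ih

theorem mem_of_mem_minPtsIn_of_mem_closure [SpectralSpace X] {U W : Set X} (hU : U ∈ qcop t)
    (hW : W ∈ qcop t) {c : X} (hc : c ∈ minPtsIn t Wᶜ) (hcl : c ∈ closure (U \ W)) : c ∈ U := by
  have hUW := sdiff_mem_constructible (mem_constructible_of_mem_qcop hU)
    (mem_constructible_of_mem_qcop hW)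
  obtain ⟨u, hu, huc⟩ := exists_specializes_of_mem_closure
    (isClopen_constructibleTopology_of_mem hUW).1 hcl
  exact hc.2 u hu.2 (specLE_iff_specializes.2 huc) ▸ hu.1

theorem PCF.IsEsakia.isCompact_minPtsIn [SpectralSpace X] (h : IsEsakia t) {C : Set X}
    (hC : C ∈ qccl t) : IsCompact (minPtsIn t C) := by
  obtain ⟨W, hW, rfl⟩ := hC
  have hWc := isClopen_constructibleTopology_of_mem (mem_constructible_of_mem_qcop hW)
  apply isCompact_of_isClosed_constructibleTopology
  rw [← @isOpen_compl_iff X _ (constructibleTopology X),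
    @isOpen_iff_forall_mem_open X (constructibleTopology X)]
  intro x hx
  by_cases hxW : x ∈ W
  · exact ⟨W, fun y hy hy' => hy'.1 hy, hWc.2, hxW⟩
  obtain ⟨y, hyW, hyx, hne⟩ : ∃ y ∉ W, y ⤳ x ∧ y ≠ x := by
    by_contra! h
    exact hx ⟨hxW, fun y hy hyx => h y hy (specLE_iff_specializes.1 hyx)⟩
  have hxy : ¬ x ⤳ y := fun hxy => hne (hyx.antisymm hxy).eq
  obtain ⟨O, hO, hyO, hxO⟩ := not_specializes_iff_exists_open.1 hxy
  obtain ⟨U, hU, hyU, hUO⟩ :=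
    PrespectralSpace.isTopologicalBasis.exists_subset_of_mem_open hyO hO
  have hUW := sdiff_mem_constructible (mem_constructible_of_mem_qcop hU)
    (mem_constructible_of_mem_qcop hW)
  have hN := sdiff_mem_constructible (h _ hUW) (mem_constructible_of_mem_qcop hU)
  refine ⟨_, ?_, (isClopen_constructibleTopology_of_mem hN).2, ?_, fun hx => hxO (hUO hx)⟩
  · exact fun c ⟨hc, hcU⟩ hcmin => hcU (mem_of_mem_minPtsIn_of_mem_closure hU hW hcmin hc)
  · exact hyx.mem_closed isClosed_closure (subset_closure ⟨hyU, hyW⟩)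

/-- If the set of minimal points of a closed constructible set `Wᶜ` is compact, then those
outside `U` can be separated from `U \ W` by a compact open set. -/
theorem exists_qcop_disjoint_sdiff [SpectralSpace X] {U W : Set X} (hU : U ∈ qcop t)
    (hW : W ∈ qcop t) (h : IsCompact (minPtsIn t Wᶜ)) :
    ∃ V ∈ qcop t, minPtsIn t Wᶜ \ U ⊆ V ∧ Disjoint V (U \ W) := by
  refine (h.diff hU.1).induction_on
    (p := fun s => ∃ V ∈ qcop t, s ⊆ V ∧ Disjoint V (U \ W)) ?_ ?_ ?_ ?_
  · exact ⟨∅, ⟨isOpen_empty, isCompact_empty⟩, subset_rfl, empty_disjoint _⟩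
  · exact fun s u hsu ⟨V, hV, huV, hd⟩ => ⟨V, hV, hsu.trans huV, hd⟩
  · exact fun s u ⟨V, hV, hs, hd⟩ ⟨V', hV', hu, hd'⟩ =>
      ⟨V ∪ V', ⟨hV.1.union hV'.1, hV.2.union hV'.2⟩, union_subset_union hs hu,
        hd.union_left hd'⟩
  · rintro c ⟨hc, hcU⟩
    have hcl : c ∈ (closure (U \ W))ᶜ := fun hmem =>
      hcU (mem_of_mem_minPtsIn_of_mem_closure hU hW hc hmem)
    obtain ⟨V, hV, hcV, hVU⟩ := PrespectralSpace.isTopologicalBasis.exists_subset_of_mem_open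
      hcl isClosed_closure.isOpen_compl
    exact ⟨V, mem_nhdsWithin_of_mem_nhds (hV.1.mem_nhds hcV), V, hV, subset_rfl,
      disjoint_left.2 fun x hx hx' => hVU hx (subset_closure hx')⟩

theorem PCF.IsForest.disjoint_closure_sdiff [SpectralSpace X] (hf : IsForest t) {U V W : Set X}
    (hU : U ∈ qcop t) (hV : V ∈ qcop t) (hW : W ∈ qcop t) (h : Disjoint V (U \ W)) :
    Disjoint (closure (V \ W)) (closure (U \ W)) := by
  have key {O : Set X} (hO : O ∈ qcop t) := (isClopen_constructibleTopology_of_mem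
    (sdiff_mem_constructible (mem_constructible_of_mem_qcop hO)
      (mem_constructible_of_mem_qcop hW))).1
  refine disjoint_left.2 fun x hxV hxU => ?_
  obtain ⟨v, hv, hvx⟩ := exists_specializes_of_mem_closure (key hV) hxV
  obtain ⟨u, hu, hux⟩ := exists_specializes_of_mem_closure (key hU) hxU
  obtain huv | hvu := hf.specializes_total hux hvx
  · exact disjoint_left.1 h (huv.mem_open hV.1 hv.1) hu
  · exact disjoint_left.1 h hv.1 ⟨hvu.mem_open hU.1 hu.1, hv.2⟩

theorem PCF.IsForest.isEsakia [SpectralSpace X] (hf : IsForest t)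
    (h : ∀ C ∈ qccl t, IsCompact (minPtsIn t C)) : IsEsakia t := by
  refine isEsakia_of_closure_sdiff fun U hU W hW => ?_
  obtain ⟨V, hV, hminV, hd⟩ := exists_qcop_disjoint_sdiff hU hW (h _ ⟨W, hW, rfl⟩)
  have hsub {O : Set X} : closure (O \ W) ⊆ Wᶜ :=
    closure_minimal (fun _ hx => hx.2) hW.1.isClosed_compl
  have hcompl : (closure (U \ W))ᶜ = W ∪ closure (V \ W) := by
    refine Subset.antisymm (fun x hx => ?_) (union_subset ?_ ?_)
    · by_cases hxW : x ∈ W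
      · exact .inl hxW
      obtain ⟨c, hc, hcx⟩ := exists_mem_minPtsIn_specializes hW.1.isClosed_compl hxW
      have hcU : c ∉ U := fun hcU =>
        hx (hcx.mem_closed isClosed_closure (subset_closure ⟨hcU, hc.1⟩))
      exact .inr (hcx.mem_closed isClosed_closure (subset_closure ⟨hminV ⟨hc, hcU⟩, hc.1⟩))
    · exact fun x hx hx' => hsub hx' hx
    · exact disjoint_left.1 (hf.disjoint_closure_sdiff hU hV hW hd)
  rw [← compl_compl (closure (U \ W))]
  refine compl_mem_constructible (mem_constructible_of_mem_qcop
    ⟨isClosed_closure.isOpen_compl, ?_⟩)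
  rw [hcompl]
  exact hW.2.union isClosed_closure.isCompact

end Spectral

/-- A spectral forest `X` is an Esakia space iff `C^min` is compact for
every `C ∈ qccl X`. -/
theorem statement_5 {X : Type*} [t : TopologicalSpace X] (hX : IsSpectral t)
    (hforest : IsForest t) :
    IsEsakia t ↔ ∀ C ∈ qccl t, IsCompact (minPtsIn t C) := by
  have := hX.spectralSpace
  exact ⟨fun h _ hC => h.isCompact_minPtsIn hC, hforest.isEsakia⟩
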